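/- There exists P such that for every prime p ≥ P the following holds. Let T = φ(p-1) - 1 and let T = p_1^{e_1} ··· p_r^{e_r} be the prime factorization of T with pairwise distinct odd primes p_1, ..., p_r and e_i ≥ 1. Then the linear complexity of the sequence (s_n) satisfies L(s_n) ≥ min{ord_{p_1}(2), ..., ord_{p_r}(2)} + ε, where ε = 1 if p ≡ 1 (mod 4) and ε = 0 if p ≡ 3 (mod 4), and ord_m(2) denotes the multiplicative order of 2 modulo m. -/

import Mathlib

open Polynomial

/-- The primitive roots modulo `p` in increasing order: `g_1 < g_2 < … < g_{φ(p-1)}`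
(0-indexed as a sorted list). -/
noncomputable def primRootsList (p : ℕ) : List ℕ :=
  ((Finset.Ico 1 p).filter fun g : ℕ => orderOf ((g : ZMod p)) = p - 1).sort (· ≤ ·)

/-- The binary sequence `s_n ≡ g_{n+1} + g_{n+2} (mod 2)` of period `T = φ(p-1) - 1`,
extended `T`-periodically. -/
noncomputable def seqS (p n : ℕ) : ℕ :=
  ((primRootsList p).getD (n % (Nat.totient (p - 1) - 1)) 0 +
    (primRootsList p).getD (n % (Nat.totient (p - 1) - 1) + 1) 0) % 2

/-- `S(X) = Σ_{n=0}^{T-1} s_n X^n ∈ F_2[X]`. -/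
noncomputable def Spoly (p : ℕ) : Polynomial (ZMod 2) :=
  ∑ n ∈ Finset.range (Nat.totient (p - 1) - 1), Polynomial.C ((seqS p n : ZMod 2)) * X ^ n

/-- The linear complexity `L(s_n) = T - deg(gcd(X^T - 1, S(X)))` of the `T`-periodic
sequence `(s_n)`, `T = φ(p-1) - 1`. -/
noncomputable def linComp (p : ℕ) : ℕ :=
  (Nat.totient (p - 1) - 1) -
    (EuclideanDomain.gcd ((X : Polynomial (ZMod 2)) ^ (Nat.totient (p - 1) - 1) - 1)
      (Spoly p)).natDegree

lemma norm_jacobiSum_le {p : ℕ} [Fact p.Prime] (χ ψ : MulChar (ZMod p) ℂ)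
    (h : ¬(χ = 1 ∧ ψ = 1)) : ‖jacobiSum χ ψ‖ ≤ √p := by
  have hp : (1 : ℝ) ≤ √p := by
    rw [Real.one_le_sqrt]
    exact_mod_cast (Fact.out : p.Prime).one_le
  by_cases hχ : χ = 1
  · subst hχ
    rw [jacobiSum_one_nontrivial (fun hψ => h ⟨rfl, hψ⟩)]
    simpa using hp
  by_cases hψ : ψ = 1
  · subst hψ
    rw [jacobiSum_comm, jacobiSum_one_nontrivial hχ]
    simpa using hp
  by_cases hχψ : χ * ψ = 1
  · rw [eq_inv_of_mul_eq_one_right hχψ, jacobiSum_nontrivial_inv hχ, norm_neg]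
    have : ‖χ (-1)‖ = 1 := by
      have h1 : χ (-1) ^ 2 = 1 := by rw [← map_pow]; simp
      have h2 : ‖χ (-1)‖ ^ 2 = 1 := by rw [← norm_pow, h1, norm_one]
      exact (pow_eq_one_iff_of_nonneg (norm_nonneg _) two_ne_zero).mp h2
    rwa [this]
  · have hc : ringChar ℂ ≠ ringChar (ZMod p) := by
      rw [ZMod.ringChar_zmod_n, ringChar.eq_zero]
      exact (Fact.out : p.Prime).ne_zero.symm
    have h1 := jacobiSum_mul_jacobiSum_inv hc hχ hψ hχψ
    have h2 : jacobiSum χ⁻¹ ψ⁻¹ = star (jacobiSum χ ψ) := by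
      simp [jacobiSum, ← MulChar.star_apply']
    rw [h2, ZMod.card] at h1
    have h3 : ‖jacobiSum χ ψ‖ ^ 2 = p := by
      have := congrArg norm h1
      rw [norm_mul, norm_star, Complex.norm_natCast] at this
      rw [sq, this]
    rw [← h3, Real.sqrt_sq (norm_nonneg _)]

lemma sum_mul_shift_eq_jacobiSum {p : ℕ} [Fact p.Prime] (χ ψ : MulChar (ZMod p) ℂ)
    {t : ZMod p} (ht : t ≠ 0) :
    ∑ x, χ x * ψ (x + t) = χ (-t) * ψ t * jacobiSum χ ψ := by
  rw [jacobiSum, Finset.mul_sum,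
    ← Equiv.sum_comp (Equiv.mulLeft₀ (-t) (neg_ne_zero.mpr ht)) (fun x => χ x * ψ (x + t))]
  refine Finset.sum_congr rfl fun x _ => ?_
  simp only [Equiv.mulLeft₀_apply]
  rw [show -t * x + t = t * (1 - x) by ring, map_mul, map_mul]
  ring

lemma norm_mulChar_apply_of_ne_zero {p : ℕ} [Fact p.Prime] (χ : MulChar (ZMod p) ℂ)
    {t : ZMod p} (ht : t ≠ 0) : ‖χ t‖ = 1 := by
  have h1 : χ t ^ (p - 1) = 1 := by rw [← map_pow, ZMod.pow_card_sub_one_eq_one ht, map_one]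
  have h2 : ‖χ t‖ ^ (p - 1) = 1 := by rw [← norm_pow, h1, norm_one]
  exact (pow_eq_one_iff_of_nonneg (norm_nonneg _)
    (Nat.sub_ne_zero_of_lt (Fact.out : p.Prime).one_lt)).mp h2

lemma norm_sum_mulChar_correlation_sub_le {p : ℕ} [Fact p.Prime] {ι : Type*} (s : Finset ι)
    (a : ι → ℂ) (χ : ι → MulChar (ZMod p) ℂ) (G : ZMod p → ℂ)
    (hG : ∀ x, G x = ∑ i ∈ s, a i * χ i x) {t : ZMod p} (ht : t ≠ 0) :
    ‖∑ x, G x * G (x + t) - ((∑ x, G x) / (p - 1)) ^ 2 * (p - 2)‖ ≤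
      (∑ i ∈ s, ‖a i‖) ^ 2 * √p := by
  classical
  have hp1 : (p : ℂ) - 1 ≠ 0 := by
    rw [sub_ne_zero]; exact_mod_cast (Fact.out : p.Prime).one_lt.ne'
  have hmean : (∑ x, G x) / (p - 1) = ∑ i ∈ s, a i * (if χ i = 1 then 1 else 0) := by
    rw [div_eq_iff hp1, Finset.sum_mul]
    simp only [hG]
    rw [Finset.sum_comm]
    refine Finset.sum_congr rfl fun i _ => ?_
    rw [← Finset.mul_sum]
    split_ifs with h
    · rw [h, MulChar.sum_one_eq_card_units, ZMod.card_units,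
        Nat.cast_sub (Fact.out : p.Prime).one_le]
      simp
    · rw [MulChar.sum_eq_zero_of_ne_one h]
      simp
  have hcorr : ∑ x, G x * G (x + t) =
      ∑ i ∈ s, ∑ j ∈ s, a i * a j * ∑ x, χ i x * χ j (x + t) := by
    simp_rw [hG, Finset.sum_mul_sum]
    rw [Finset.sum_comm]
    refine Finset.sum_congr rfl fun i _ => ?_
    rw [Finset.sum_comm]
    refine Finset.sum_congr rfl fun j _ => ?_
    rw [Finset.mul_sum]
    exact Finset.sum_congr rfl fun x _ => by ring
  rw [hcorr, hmean, sq, Finset.sum_mul_sum, Finset.sum_mul, ← Finset.sum_sub_distrib, sq,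
    Finset.sum_mul_sum, Finset.sum_mul]
  refine (norm_sum_le _ _).trans (Finset.sum_le_sum fun i _ => ?_)
  rw [Finset.sum_mul, ← Finset.sum_sub_distrib, Finset.sum_mul]
  refine (norm_sum_le _ _).trans (Finset.sum_le_sum fun j _ => ?_)
  rw [show ∀ u v w z y : ℂ, u * v * w - u * z * (v * y) * (p - 2) =
    u * v * (w - z * y * (p - 2)) by intros; ring, norm_mul, norm_mul]
  refine mul_le_mul_of_nonneg_left ?_ (by positivity)
  rw [sum_mul_shift_eq_jacobiSum _ _ ht]
  by_cases h : χ i = 1 ∧ χ j = 1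
  · rw [h.1, h.2, jacobiSum_one_one, MulChar.one_apply (neg_ne_zero.mpr ht).isUnit,
      MulChar.one_apply ht.isUnit]
    simp
  · have h0 : ((if χ i = 1 then 1 else 0) * (if χ j = 1 then 1 else 0) : ℂ) = 0 := by
      rw [not_and_or] at h
      rcases h with h | h <;> simp [h]
    rw [h0, zero_mul, sub_zero, norm_mul, norm_mul,
      norm_mulChar_apply_of_ne_zero _ (neg_ne_zero.mpr ht), norm_mulChar_apply_of_ne_zero _ ht,
      one_mul, one_mul]
    exact norm_jacobiSum_le _ _ h

lemma exists_mulChar_pow_eq_one_iff (p : ℕ) [Fact p.Prime] :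
    ∃ χ : MulChar (ZMod p) ℂ, ∀ x : ZMod p, x ≠ 0 → ∀ k : ℕ, χ x ^ k = 1 ↔ x ^ k = 1 := by
  classical
  have hp1 : p - 1 ≠ 0 := Nat.sub_ne_zero_of_lt (Fact.out : p.Prime).one_lt
  have hcard : Fintype.card (ZMod p)ˣ = p - 1 := ZMod.card_units p
  obtain ⟨χ, hχ⟩ := MulChar.exists_mulChar_orderOf (n := p - 1) (ZMod p)
    (by rw [ZMod.card]) (Complex.isPrimitiveRoot_exp _ hp1)
  refine ⟨χ, fun x hx k => ⟨fun h => ?_, fun h => by rw [← map_pow, h, map_one]⟩⟩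
  obtain ⟨g, hg⟩ := IsCyclic.exists_generator (α := (ZMod p)ˣ)
  have hord : p - 1 ∣ orderOf (χ g) := by
    rw [← hχ, orderOf_dvd_iff_pow_eq_one, MulChar.eq_iff hg]
    rw [MulChar.pow_apply_coe, pow_orderOf_eq_one, MulChar.one_apply_coe]
  obtain ⟨j, hj⟩ := (mem_powers_iff_mem_zpowers (x := g)).mpr (hg (Units.mk0 x hx))
  have hxj : x = (g : ZMod p) ^ j := by
    have := congrArg Units.val hj
    simpa using this.symm
  rw [hxj, map_pow, ← pow_mul, ← orderOf_dvd_iff_pow_eq_one] at h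
  obtain ⟨m, hm⟩ := hord.trans h
  rw [hxj, ← pow_mul, hm, pow_mul, ZMod.pow_card_sub_one_eq_one g.ne_zero, one_pow]

/-- The indicator function of the primitive roots modulo `p`. -/
noncomputable def primInd (p : ℕ) (x : ZMod p) : ℝ := if orderOf x = p - 1 then 1 else 0

lemma sum_moebius_pow_div_eq_one {n : ℕ} (hn : n ≠ 0) {G : Type*} [Monoid G] [DecidableEq G] {x : G}
    (hx : x ^ n = 1) :
    ∑ d ∈ n.divisors, (ArithmeticFunction.moebius d : ℂ) * (if x ^ (n / d) = 1 then 1 else 0) =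
      if orderOf x = n then 1 else 0 := by
  have hdvd : orderOf x ∣ n := orderOf_dvd_of_pow_eq_one hx
  obtain ⟨m, hm⟩ := hdvd
  have ho : 0 < orderOf x := Nat.pos_of_ne_zero fun h => hn (by rw [hm, h, zero_mul])
  have hm0 : m ≠ 0 := fun h => hn (by rw [hm, h, mul_zero])
  have hiff : ∀ d ∈ n.divisors, (x ^ (n / d) = 1 ↔ d ∣ m) := by
    intro d hd
    have hdn := Nat.dvd_of_mem_divisors hd
    have hd0 : 0 < d := Nat.pos_of_mem_divisors hd
    rw [← orderOf_dvd_iff_pow_eq_one, Nat.dvd_div_iff_mul_dvd hdn]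
    conv_lhs => rw [hm]
    rw [mul_comm d, Nat.mul_dvd_mul_iff_left ho]
  have hfil : n.divisors.filter (· ∣ m) = m.divisors := by
    ext d
    simp only [Finset.mem_filter, Nat.mem_divisors]
    exact ⟨fun h => ⟨h.2, hm0⟩, fun h => ⟨⟨h.1.trans ⟨_, hm.trans (mul_comm _ _)⟩, hn⟩, h.1⟩⟩
  have h1 : ∑ d ∈ n.divisors, (ArithmeticFunction.moebius d : ℂ) *
      (if x ^ (n / d) = 1 then 1 else 0) = ∑ d ∈ m.divisors, (ArithmeticFunction.moebius d : ℂ) := by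
    rw [← hfil, Finset.sum_filter]
    refine Finset.sum_congr rfl fun d hd => ?_
    simp only [hiff d hd, mul_ite, mul_one, mul_zero]
  have h2 := congrArg (fun f => f m) (ArithmeticFunction.coe_moebius_mul_coe_zeta (R := ℂ))
  rw [ArithmeticFunction.coe_mul_zeta_apply, ArithmeticFunction.one_apply] at h2
  rw [h1]
  refine Eq.trans h2 ?_
  have : m = 1 ↔ orderOf x = n := by
    constructor
    · rintro rfl; rw [hm, mul_one]
    · intro h
      rw [h] at hm
      exact Nat.eq_of_mul_eq_mul_left (Nat.pos_of_ne_zero hn) (by rw [← hm, mul_one])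
  simp only [this]

lemma sum_norm_moebius_eq {n : ℕ} (hn : n ≠ 0) :
    ∑ d ∈ n.divisors, ‖(ArithmeticFunction.moebius d : ℂ)‖ = 2 ^ n.primeFactors.card := by
  have h : ∀ d ∈ n.divisors, ‖(ArithmeticFunction.moebius d : ℂ)‖ =
      if Squarefree d then 1 else 0 := by
    intro d _
    rw [Complex.norm_intCast, ← Int.cast_abs, ArithmeticFunction.abs_moebius]
    split_ifs <;> simp
  rw [Finset.sum_congr rfl h, ← Finset.sum_filter, Nat.sum_divisors_filter_squarefree hn]
  rw [Finset.sum_const, Finset.card_powerset, Nat.factors_eq]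
  simp

lemma geom_sum_eq_ite {d : ℕ} {y : ℂ} (hd : d ≠ 0) (hy : y ^ d = 1) :
    ∑ i ∈ Finset.range d, 1 / (d : ℂ) * y ^ i = if y = 1 then 1 else 0 := by
  rw [← Finset.mul_sum]
  split_ifs with h
  · simp [h, hd]
  · rw [geom_sum_eq h, hy]; simp

lemma abs_primInd_correlation_sub_le {p : ℕ} [Fact p.Prime] {t : ZMod p} (ht : t ≠ 0) :
    |∑ x, primInd p x * primInd p (x + t) - ((∑ x, primInd p x) / (p - 1)) ^ 2 * (p - 2)| ≤
      ((2 : ℝ) ^ (p - 1).primeFactors.card) ^ 2 * √p := by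
  classical
  have hp1 : p - 1 ≠ 0 := Nat.sub_ne_zero_of_lt (Fact.out : p.Prime).one_lt
  obtain ⟨χ, hχ⟩ := exists_mulChar_pow_eq_one_iff p
  have key := norm_sum_mulChar_correlation_sub_le
    ((p - 1).divisors.sigma fun d => Finset.range d)
    (fun i => (ArithmeticFunction.moebius i.1 : ℂ) * (1 / i.1))
    (fun i => (χ ^ ((p - 1) / i.1)) ^ i.2) (fun x => (primInd p x : ℂ)) (fun x => ?_) ht
  · have hA : ∑ i ∈ (p - 1).divisors.sigma fun d => Finset.range d,
        ‖(ArithmeticFunction.moebius i.1 : ℂ) * (1 / i.1)‖ = 2 ^ (p - 1).primeFactors.card := by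
      rw [← sum_norm_moebius_eq hp1, Finset.sum_sigma]
      refine Finset.sum_congr rfl fun d hd => ?_
      have hd0 : (d : ℝ) ≠ 0 := by exact_mod_cast (Nat.pos_of_mem_divisors hd).ne'
      simp
      field_simp
    rw [hA] at key
    rw [← Real.norm_eq_abs, ← Complex.norm_real]
    push_cast
    exact key
  · rw [Finset.sum_sigma]
    by_cases hx : x = 0
    · subst hx
      rw [Finset.sum_eq_zero]
      · rw [primInd, if_neg]
        · simp
        · rw [orderOf_zero]; exact hp1.symm
      · intro d _
        refine Finset.sum_eq_zero fun i _ => ?_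
        rw [MulChar.map_zero, mul_zero]
    · have hxn : x ^ (p - 1) = 1 := ZMod.pow_card_sub_one_eq_one hx
      have := sum_moebius_pow_div_eq_one hp1 hxn
      simp only [primInd]
      rw [apply_ite Complex.ofReal, Complex.ofReal_one, Complex.ofReal_zero, ← this]
      refine Finset.sum_congr rfl fun d hd => ?_
      have hd0 := (Nat.pos_of_mem_divisors hd).ne'
      have hev : ∀ i : ℕ, ((χ ^ ((p - 1) / d)) ^ i) x = (χ x ^ ((p - 1) / d)) ^ i := by
        intro i
        rw [← Units.val_mk0 hx, MulChar.pow_apply_coe, MulChar.pow_apply_coe]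
      have hy : (χ x ^ ((p - 1) / d)) ^ d = 1 := by
        rw [← pow_mul, Nat.div_mul_cancel (Nat.dvd_of_mem_divisors hd), hχ x hx, hxn]
      simp only [hev, mul_assoc]
      rw [← Finset.mul_sum, geom_sum_eq_ite hd0 hy]
      simp only [hχ x hx]

lemma pow_card_primeFactors_le (K : ℕ) {n : ℕ} (hK : 0 < K) (hn : n ≠ 0) :
    K ^ n.primeFactors.card ≤ K ^ K * n := by
  classical
  have h1 : ∏ q ∈ n.primeFactors, K ≤ ∏ q ∈ n.primeFactors, ((if q < K then K else 1) * q) := by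
    refine Finset.prod_le_prod' fun q hq => ?_
    have := (Nat.prime_of_mem_primeFactors hq).pos
    split_ifs with h
    · exact Nat.le_mul_of_pos_right _ this
    · omega
  rw [Finset.prod_const, Finset.prod_mul_distrib] at h1
  refine h1.trans (Nat.mul_le_mul ?_ (Nat.le_of_dvd (Nat.pos_of_ne_zero hn)
    (Nat.prod_primeFactors_dvd n)))
  rw [← Finset.prod_filter, Finset.prod_const]
  refine Nat.pow_le_pow_right hK ?_
  calc _ ≤ (Finset.range K).card := Finset.card_le_card fun q hq => by
        simpa using (Finset.mem_filter.mp hq).2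
    _ = K := Finset.card_range K

lemma exists_forall_mul_two_pow_card_primeFactors_le (C : ℕ) :
    ∃ N : ℕ, ∀ n ≥ N, C * (2 ^ n.primeFactors.card) ^ 8 ≤ n := by
  obtain ⟨D, hD⟩ : ∃ D : ℕ, D = (2 ^ 9) ^ (2 ^ 9) := ⟨_, rfl⟩
  refine ⟨C * (C * D) ^ 8 + 1, fun n hn => ?_⟩
  have hn0 : n ≠ 0 := by omega
  have h := pow_card_primeFactors_le (2 ^ 9) (by norm_num) hn0
  rw [← hD, ← pow_mul, mul_comm 9, pow_mul] at h
  generalize 2 ^ n.primeFactors.card = W at *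
  rcases le_total W (C * D) with hW | hW
  · have := Nat.mul_le_mul_left C (Nat.pow_le_pow_left hW 8)
    omega
  · have hDpos : 0 < D := by rw [hD]; exact Nat.pos_of_ne_zero (pow_ne_zero _ (by norm_num))
    refine Nat.le_of_mul_le_mul_left ?_ hDpos
    calc D * (C * W ^ 8) = C * D * W ^ 8 := by ring
      _ ≤ W * W ^ 8 := Nat.mul_le_mul_right _ hW
      _ = W ^ 9 := by ring
      _ ≤ D * n := h

lemma le_totient_mul_two_pow_card_primeFactors (n : ℕ) :
    n ≤ n.totient * 2 ^ n.primeFactors.card := by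
  have hpos : 0 < ∏ q ∈ n.primeFactors, q :=
    Finset.prod_pos fun q hq => (Nat.prime_of_mem_primeFactors hq).pos
  refine Nat.le_of_mul_le_mul_right ?_ hpos
  rw [mul_right_comm, Nat.totient_mul_prod_primeFactors, mul_assoc]
  refine Nat.mul_le_mul_left n ?_
  rw [← Finset.prod_const, ← Finset.prod_mul_distrib]
  refine Finset.prod_le_prod' fun q hq => ?_
  have := (Nat.prime_of_mem_primeFactors hq).two_le
  omega

lemma two_mul_totient_le {n : ℕ} (hn : Even n) : 2 * n.totient ≤ n := by
  induction n using Nat.strong_induction_on with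
  | _ n ih =>
    obtain ⟨m, rfl⟩ := hn
    rcases Nat.even_or_odd m with hm | hm
    · rcases Nat.eq_zero_or_pos m with rfl | hpos
      · simp
      · have := ih m (by omega) hm
        rw [← two_mul, Nat.totient_two_mul_of_even hm]
        omega
    · rw [← two_mul, Nat.totient_two_mul_of_odd hm]
      exact Nat.mul_le_mul_left 2 (Nat.totient_le m)

lemma sum_range_natCast_zmod {p : ℕ} [NeZero p] {M : Type*} [AddCommMonoid M] (F : ZMod p → M) :
    ∑ j ∈ Finset.range p, F (j : ZMod p) = ∑ x, F x := by
  refine Finset.sum_nbij' (fun j => (j : ZMod p)) ZMod.val (by simp) ?_ ?_ (by simp) (by simp)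
  · intro x _
    simpa using ZMod.val_lt x
  · intro j hj
    exact ZMod.val_cast_of_lt (Finset.mem_range.mp hj)

lemma card_filter_orderOf_zmod (p : ℕ) [Fact p.Prime] :
    (Finset.univ.filter fun x : ZMod p => orderOf x = p - 1).card = (p - 1).totient := by
  classical
  have hp1 : p - 1 ≠ 0 := Nat.sub_ne_zero_of_lt (Fact.out : p.Prime).one_lt
  have h := IsCyclic.card_orderOf_eq_totient (α := (ZMod p)ˣ) (d := p - 1)
    (by rw [ZMod.card_units])
  rw [← h]
  symm
  refine Finset.card_bij (fun u _ => (u : ZMod p)) ?_ (fun _ _ _ _ h => Units.ext h) ?_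
  · intro u hu
    simpa [orderOf_units] using hu
  · intro x hx
    have hx' := (Finset.mem_filter.mp hx).2
    have hx0 : x ≠ 0 := by
      rintro rfl
      rw [orderOf_zero] at hx'
      exact hp1 hx'.symm
    refine ⟨Units.mk0 x hx0, ?_, rfl⟩
    simpa [← orderOf_units] using hx'

lemma sum_primInd (p : ℕ) [Fact p.Prime] : ∑ x, primInd p x = (p - 1).totient := by
  classical
  rw [← card_filter_orderOf_zmod]
  simp [primInd]

lemma primInd_mul_self (p : ℕ) (x : ZMod p) : primInd p x * primInd p x = primInd p x := by
  unfold primInd; split_ifs <;> simp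

lemma primInd_nonneg (p : ℕ) (x : ZMod p) : 0 ≤ primInd p x := by
  unfold primInd; split_ifs <;> simp

lemma primInd_le_one (p : ℕ) (x : ZMod p) : primInd p x ≤ 1 := by
  unfold primInd; split_ifs <;> simp

lemma sum_neg_one_pow_even {H : ℕ} (hH : Even H) : ∑ h ∈ Finset.range H, (-1 : ℝ) ^ h = 0 := by
  rw [neg_one_geom_sum, if_pos hH]

lemma sum_sq_alternating_window_ge {p : ℕ} [Fact p.Prime] (G : ZMod p → ℝ) {M E S : ℝ}
    (hE : 0 ≤ E) (hS : ∑ x, G x * G x = S)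
    (hcorr : ∀ t : ZMod p, t ≠ 0 → |∑ x, G x * G (x + t) - M| ≤ E)
    {H : ℕ} (hH : Even H) (hHp : H ≤ p) :
    H * (S - M) - H ^ 2 * E ≤
      ∑ x : ZMod p, (∑ h ∈ Finset.range H, (-1) ^ h * G (x + h)) ^ 2 := by
  have hexp : ∑ x : ZMod p, (∑ h ∈ Finset.range H, (-1) ^ h * G (x + h)) ^ 2 =
      ∑ h ∈ Finset.range H, ∑ k ∈ Finset.range H,
        (-1) ^ h * (-1) ^ k * (∑ x : ZMod p, G x * G (x + (k - h))) := by
    simp_rw [sq, Finset.sum_mul_sum]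
    rw [Finset.sum_comm]
    refine Finset.sum_congr rfl fun h _ => ?_
    rw [Finset.sum_comm]
    refine Finset.sum_congr rfl fun k _ => ?_
    rw [← Equiv.sum_comp (Equiv.addRight (h : ZMod p)) (fun x => G x * G (x + (k - h))),
      Finset.mul_sum]
    refine Finset.sum_congr rfl fun x _ => ?_
    simp only [Equiv.coe_addRight]
    rw [show x + (h : ZMod p) + (k - h) = x + k by ring]
    ring
  have hzero : ∑ h ∈ Finset.range H, ∑ k ∈ Finset.range H, (-1 : ℝ) ^ h * (-1) ^ k * M = 0 := by
    simp_rw [← Finset.sum_mul]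
    rw [← Finset.sum_mul_sum, sum_neg_one_pow_even hH]
    simp
  have hterm : ∀ h ∈ Finset.range H, ∀ k ∈ Finset.range H,
      (if h = k then S - M else 0) - E ≤
        (-1 : ℝ) ^ h * (-1) ^ k * (∑ x : ZMod p, G x * G (x + (k - h))) -
          (-1) ^ h * (-1) ^ k * M := by
    intro h hh k hk
    rw [← mul_sub]
    split_ifs with hhk
    · subst hhk
      rw [← mul_pow]
      simp [hS, hE]
    · have ht : (k : ZMod p) - h ≠ 0 := by
        rw [sub_ne_zero, Ne, ZMod.natCast_eq_natCast_iff']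
        rw [Finset.mem_range] at hh hk
        rw [Nat.mod_eq_of_lt (by omega), Nat.mod_eq_of_lt (by omega)]
        exact fun h' => hhk h'.symm
      have h1 := hcorr _ ht
      rw [zero_sub]
      refine (neg_le_neg h1).trans ?_
      have h2 : |(-1 : ℝ) ^ h * (-1) ^ k * (∑ x : ZMod p, G x * G (x + (k - h)) - M)| =
          |∑ x : ZMod p, G x * G (x + (k - h)) - M| := by
        rw [abs_mul, abs_mul, abs_pow, abs_pow]; simp
      rw [← h2]
      exact neg_abs_le _
  have := Finset.sum_le_sum fun h hh => Finset.sum_le_sum fun k hk => hterm h hh k hk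
  simp only [Finset.sum_sub_distrib, Finset.sum_const, Finset.card_range, nsmul_eq_mul] at this
  rw [hzero, ← hexp, sub_zero] at this
  refine le_trans (le_of_eq ?_) this
  congr 1
  · rw [Finset.sum_congr rfl fun h hh => by rw [Finset.sum_ite_eq, if_pos hh]]
    simp [mul_sub]
  · ring

lemma sum_sq_alternating_window_le {p : ℕ} [Fact p.Prime] (G : ZMod p → ℝ)
    (hG : ∀ x, |G x| ≤ 1)
    (hD : ∀ a b : ℕ, a ≤ p → b ≤ p → |∑ j ∈ Finset.range b, (-1) ^ j * G j -
      ∑ j ∈ Finset.range a, (-1) ^ j * G j| ≤ 1)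
    {H : ℕ} (hHp : H ≤ p) :
    ∑ x : ZMod p, (∑ h ∈ Finset.range H, (-1) ^ h * G (x + h)) ^ 2 ≤ p + H ^ 3 := by
  rw [← sum_range_natCast_zmod]
  obtain ⟨m, hm⟩ := Nat.exists_eq_add_of_le' hHp
  have h1 : ∀ j ∈ Finset.range m,
      (∑ h ∈ Finset.range H, (-1) ^ h * G ((j : ZMod p) + h)) ^ 2 ≤ 1 := by
    intro j hj
    rw [Finset.mem_range] at hj
    have h := hD j (j + H) (by omega) (by omega)
    rw [Finset.sum_range_add, add_sub_cancel_left] at h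
    have h2 : ∑ h ∈ Finset.range H, (-1 : ℝ) ^ (j + h) * G ((j + h : ℕ) : ZMod p) =
        (-1) ^ j * ∑ h ∈ Finset.range H, (-1) ^ h * G ((j : ZMod p) + h) := by
      rw [Finset.mul_sum]
      refine Finset.sum_congr rfl fun h _ => ?_
      push_cast
      ring
    rw [h2, abs_mul, abs_pow, abs_neg, abs_one, one_pow, one_mul] at h
    exact (sq_le_one_iff_abs_le_one _).mpr h
  have h2 : ∀ j : ℕ, (∑ h ∈ Finset.range H, (-1) ^ h * G ((j : ZMod p) + h)) ^ 2 ≤ (H : ℝ) ^ 2 := by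
    intro j
    rw [sq_le_sq, Nat.abs_cast]
    refine (Finset.abs_sum_le_sum_abs _ _).trans ?_
    calc _ ≤ ∑ h ∈ Finset.range H, (1 : ℝ) := Finset.sum_le_sum fun h _ => by
          rw [abs_mul, abs_pow, abs_neg, abs_one, one_pow, one_mul]; exact hG _
      _ = H := by simp
  have hr : Finset.range p = Finset.range (m + H) := by rw [hm]
  rw [hr, Finset.sum_range_add]
  have h3 := Finset.sum_le_sum h1
  have h4 := Finset.sum_le_sum fun j (_ : j ∈ Finset.range H) => h2 (m + j)
  simp only [Finset.sum_const, Finset.card_range, nsmul_eq_mul, mul_one] at h3 h4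
  have h5 : (m : ℝ) ≤ p := by rw [hm]; push_cast; linarith [Nat.cast_nonneg (α := ℝ) H]
  calc _ ≤ (m : ℝ) + H * H ^ 2 := add_le_add h3 h4
    _ ≤ p + H ^ 3 := by nlinarith

lemma exists_forall_prime_primitiveRoot_distribution :
    ∃ P : ℕ, ∀ p : ℕ, p.Prime → P ≤ p →
      (∃ x : ZMod p, orderOf x = p - 1 ∧ orderOf (x + 1) = p - 1) ∧
      ∃ a b : ℕ, a ≤ p ∧ b ≤ p ∧
        1 < |∑ j ∈ Finset.range b, (-1) ^ j * primInd p j -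
          ∑ j ∈ Finset.range a, (-1) ^ j * primInd p j| := by
  obtain ⟨N, hN⟩ := exists_forall_mul_two_pow_card_primeFactors_le 1000000
  refine ⟨N + 3, fun p hp hpN => ?_⟩
  have := Fact.mk hp
  have hn0 : p - 1 ≠ 0 := by omega
  have hWn := hN (p - 1) (by omega)
  have hφ1 := le_totient_mul_two_pow_card_primeFactors (p - 1)
  have hφ2 := two_mul_totient_le (hp.even_sub_one (by omega))
  have hsum := sum_primInd p
  have hcorr := fun (t : ZMod p) (ht : t ≠ 0) => abs_primInd_correlation_sub_le ht
  have hW1 : 1 ≤ 2 ^ (p - 1).primeFactors.card := Nat.one_le_two_pow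
  have hW : ((2 : ℝ) ^ (p - 1).primeFactors.card) =
    ((2 ^ (p - 1).primeFactors.card : ℕ) : ℝ) := by push_cast; rfl
  rw [hW] at hcorr
  rw [hsum] at hcorr
  generalize 2 ^ (p - 1).primeFactors.card = W at *
  generalize (p - 1).totient = S at *
  have hpn : ((p - 1 : ℕ) : ℝ) = p - 1 := by push_cast [hp.one_le]; rfl
  have hWn' : 1000000 * (W : ℝ) ^ 8 ≤ p - 1 := by rw [← hpn]; exact_mod_cast hWn
  have hS1 : (p : ℝ) - 1 ≤ S * W := by rw [← hpn]; exact_mod_cast hφ1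
  have hS2 : 2 * (S : ℝ) ≤ p - 1 := by rw [← hpn]; exact_mod_cast hφ2
  have hW1' : (1 : ℝ) ≤ W := by exact_mod_cast hW1
  have hW8 : (1 : ℝ) ≤ (W : ℝ) ^ 8 := one_le_pow₀ hW1'
  have hsqrt : 1000 * (W : ℝ) ^ 4 * √p ≤ p := by
    have h1 : 1000 * (W : ℝ) ^ 4 ≤ √p := Real.le_sqrt_of_sq_le (by nlinarith)
    calc _ ≤ √p * √p := mul_le_mul_of_nonneg_right h1 (Real.sqrt_nonneg _)
      _ = p := Real.mul_self_sqrt (Nat.cast_nonneg _)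
  set M : ℝ := ((S : ℝ) / (p - 1)) ^ 2 * (p - 2) with hM
  have hp1 : (0 : ℝ) < p - 1 := by linarith
  have hp2 : (0 : ℝ) ≤ p - 2 := by linarith
  constructor
  · by_contra! hcon
    have h := hcorr 1 one_ne_zero
    rw [Finset.sum_eq_zero, zero_sub, abs_neg, abs_le] at h
    · have hSW : 1 / (W : ℝ) ≤ S / (p - 1) := by
        rw [div_le_div_iff₀ (by linarith) hp1]; linarith
      have h1 : (1 / (W : ℝ)) ^ 2 ≤ (S / (p - 1)) ^ 2 := by gcongr
      have h2 : (1 / (W : ℝ)) ^ 2 * (p - 2) ≤ W ^ 2 * √p :=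
        (mul_le_mul_of_nonneg_right h1 hp2).trans h.2
      have hW2 : (0 : ℝ) < W ^ 2 := by positivity
      have h3 : (p : ℝ) - 2 ≤ W ^ 4 * √p := by
        calc (p : ℝ) - 2 = W ^ 2 * ((1 / (W : ℝ)) ^ 2 * (p - 2)) := by field_simp
          _ ≤ W ^ 2 * (W ^ 2 * √p) := mul_le_mul_of_nonneg_left h2 hW2.le
          _ = W ^ 4 * √p := by ring
      linarith
    · intro x _
      by_cases hx : orderOf x = p - 1
      · simp [primInd, hcon x hx]
      · simp [primInd, hx]
  · by_contra! hcon
    have hHp : 8 * W ≤ p := by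
      have : W ≤ W ^ 8 := Nat.le_self_pow (by norm_num) W
      omega
    have hupper := sum_sq_alternating_window_le (primInd p)
      (fun x => abs_le.mpr ⟨by linarith [primInd_nonneg p x], primInd_le_one p x⟩)
      (fun a b ha hb => hcon a b ha hb) hHp
    have hlower := sum_sq_alternating_window_ge (primInd p) (by positivity)
      (S := S)
      (by simp only [primInd_mul_self, hsum]) hcorr (H := 8 * W) (Even.mul_right (by decide) W)
      hHp
    have hMS : M ≤ S / 2 := by
      have h1 : (S : ℝ) / (p - 1) ≤ 1 / 2 := by rw [div_le_iff₀ hp1]; linarith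
      calc M = (S / (p - 1)) * ((S / (p - 1)) * (p - 2)) := by rw [hM]; ring
        _ ≤ (1 / 2) * ((S / (p - 1)) * (p - 1)) := by gcongr; linarith
        _ = S / 2 := by rw [div_mul_cancel₀ _ hp1.ne']; ring
    have h := hlower.trans hupper
    push_cast at h
    have h1 : 8 * (W : ℝ) * (S / 2) ≤ 8 * W * (S - M) := by gcongr; linarith
    have h2 : (W : ℝ) ^ 3 ≤ W ^ 8 := pow_le_pow_right₀ hW1' (by norm_num)
    nlinarith

lemma primRootsList_mem {p g : ℕ} :
    g ∈ primRootsList p ↔ (1 ≤ g ∧ g < p) ∧ orderOf (g : ZMod p) = p - 1 := by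
  simp [primRootsList]

lemma primRootsList_sortedLT (p : ℕ) : (primRootsList p).SortedLT :=
  Finset.sortedLT_sort _

lemma sum_map_primRootsList (p : ℕ) [Fact p.Prime] {M : Type*} [AddCommMonoid M] (f : ℕ → M) :
    ((primRootsList p).map f).sum =
      ∑ g ∈ Finset.range p, if orderOf (g : ZMod p) = p - 1 then f g else 0 := by
  classical
  have hp := (Fact.out : p.Prime).one_lt
  rw [Finset.range_eq_Ico, Finset.sum_eq_sum_Ico_succ_bot (by omega), if_neg, zero_add,
    ← Finset.sum_filter]
  · rw [Finset.sum, ← Finset.sort_eq _ (· ≤ ·), Multiset.map_coe, Multiset.sum_coe]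
    rfl
  · rw [Nat.cast_zero, orderOf_zero]; omega

lemma length_primRootsList (p : ℕ) [Fact p.Prime] :
    (primRootsList p).length = (p - 1).totient := by
  have h := sum_map_primRootsList p (fun _ => 1)
  rw [sum_range_natCast_zmod (fun x : ZMod p => if orderOf x = p - 1 then 1 else 0)] at h
  rw [← card_filter_orderOf_zmod p, Finset.card_filter, ← h]
  simp

lemma sum_alternating_prefix {l : List ℕ} (hl : l.SortedLT)
    (hc : l.IsChain fun a b => (a + b) % 2 = 1) (y : ℕ) :
    (l.map fun g => if g < y then (-1 : ℝ) ^ g else 0).sum = 0 ∨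
      (l.map fun g => if g < y then (-1 : ℝ) ^ g else 0).sum = (-1) ^ l.headD 0 := by
  induction l with
  | nil => simp
  | cons a l ih =>
    have hl' := hl.pairwise
    rw [List.pairwise_cons] at hl'
    by_cases hay : a < y
    · rcases l with _ | ⟨b, l⟩
      · simp [hay]
      · rw [List.isChain_cons_cons] at hc
        have hneg : (-1 : ℝ) ^ b = - (-1) ^ a := by
          rcases Nat.even_or_odd a with ha | ha
          · have hb : Odd b := by rw [Nat.odd_iff]; rw [Nat.even_iff] at ha; omega
            rw [ha.neg_one_pow, hb.neg_one_pow]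
          · have hb : Even b := by rw [Nat.even_iff]; rw [Nat.odd_iff] at ha; omega
            rw [ha.neg_one_pow, hb.neg_one_pow, neg_neg]
        rw [List.map_cons, List.sum_cons, if_pos hay]
        rcases ih hl'.2.sortedLT hc.2 with h | h
        · right; rw [h]; simp
        · left; rw [h]; simp [hneg]
    · left
      rw [List.sum_eq_zero]
      intro z hz
      obtain ⟨g, hg, rfl⟩ := List.mem_map.mp hz
      rw [if_neg]
      rcases List.mem_cons.mp hg with rfl | hg
      · exact hay
      · have := hl'.1 g hg
        omega

lemma sum_range_alternating_primInd (p : ℕ) [Fact p.Prime] {y : ℕ} (hy : y ≤ p) :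
    ∑ j ∈ Finset.range y, (-1) ^ j * primInd p j =
      ((primRootsList p).map fun g => if g < y then (-1 : ℝ) ^ g else 0).sum := by
  rw [sum_map_primRootsList, ← Finset.sum_subset (Finset.range_mono hy)]
  · refine Finset.sum_congr rfl fun j hj => ?_
    rw [if_pos (Finset.mem_range.mp hj), primInd]
    simp
  · intro j _ hj
    rw [Finset.mem_range] at hj
    simp [hj]

lemma abs_sum_alternating_le_one_of_isChain {p : ℕ} [Fact p.Prime]
    (hc : (primRootsList p).IsChain fun a b => (a + b) % 2 = 1) {a b : ℕ} (ha : a ≤ p)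
    (hb : b ≤ p) :
    |∑ j ∈ Finset.range b, (-1) ^ j * primInd p j -
      ∑ j ∈ Finset.range a, (-1) ^ j * primInd p j| ≤ 1 := by
  rw [sum_range_alternating_primInd p ha, sum_range_alternating_primInd p hb]
  have hl := primRootsList_sortedLT p
  rcases sum_alternating_prefix hl hc a with h | h <;>
    rcases sum_alternating_prefix hl hc b with h' | h' <;> rw [h, h'] <;> simp

lemma exists_forall_prime_seqS_not_constant :
    ∃ P : ℕ, ∀ p : ℕ, p.Prime → P ≤ p →
      ¬ ∃ c, ∀ n < (p - 1).totient - 1, seqS p n = c := by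
  obtain ⟨P, hP⟩ := exists_forall_prime_primitiveRoot_distribution
  refine ⟨P, fun p hp hpP ⟨c, hc⟩ => ?_⟩
  have := Fact.mk hp
  obtain ⟨⟨x, hx, hx1⟩, a, b, ha, hb, hab⟩ := hP p hp hpP
  have hlen := length_primRootsList p
  have hget : ∀ n (h : n + 1 < (primRootsList p).length),
      ((primRootsList p)[n] + (primRootsList p)[n + 1]) % 2 = c := by
    intro n h
    rw [← hc n (by omega), seqS, Nat.mod_eq_of_lt (a := n) (by omega),
      List.getD_eq_getElem _ _ (by omega), List.getD_eq_getElem _ _ (by omega)]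
  by_cases hc1 : c = 1
  · subst hc1
    exact hab.not_ge (abs_sum_alternating_le_one_of_isChain
      (List.isChain_iff_getElem.mpr hget) ha hb)
  · have hpar : ∀ n (h : n < (primRootsList p).length),
        (primRootsList p)[n] % 2 = (primRootsList p)[0] % 2 := by
      intro n
      induction n with
      | zero => intro _; rfl
      | succ n ih =>
        intro h
        have h1 := ih (by omega)
        have h2 := hget n h
        omega
    have hp1 := hp.one_lt
    have hval : ∀ y : ZMod p, orderOf y = p - 1 →
        y.val % 2 = (primRootsList p).headD 0 % 2 := by
      intro y hy
      have hy0 : y ≠ 0 := by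
        rintro rfl
        rw [orderOf_zero] at hy
        omega
      have hmem : y.val ∈ primRootsList p := by
        rw [primRootsList_mem, ZMod.natCast_zmod_val]
        exact ⟨⟨Nat.one_le_iff_ne_zero.mpr ((ZMod.val_ne_zero y).mpr hy0), ZMod.val_lt y⟩, hy⟩
      obtain ⟨n, hn, hny⟩ := List.getElem_of_mem hmem
      rw [← hny, hpar n hn, List.headD_eq_head?_getD, List.head?_eq_getElem?,
        List.getElem?_eq_getElem (by omega), Option.getD_some]
    have h1 := hval x hx
    have h2 := hval (x + 1) hx1
    have hlt : x.val + 1 < p := by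
      by_contra hge
      have hv : x.val + 1 = p := by have := ZMod.val_lt x; omega
      have hx0 : x + 1 = 0 := by
        have := congrArg (Nat.cast : ℕ → ZMod p) hv
        simpa using this
      rw [hx0, orderOf_zero] at hx1
      omega
    have : Fact (1 < p) := ⟨hp1⟩
    rw [ZMod.val_add_of_lt (by rwa [ZMod.val_one]), ZMod.val_one] at h2
    omega

lemma natDegree_ge_of_dvd_X_pow_sub_one {T m : ℕ} (hT : T ≠ 0)
    (hm : ∀ q : ℕ, q.Prime → q ∣ T → m ≤ orderOf (2 : ZMod q))
    {Q : (ZMod 2)[X]} (hQ : Q ∣ X ^ T - 1) (hu : ¬ IsUnit Q) (h1 : ¬ (X - 1 : (ZMod 2)[X]) ∣ Q) :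
    m ≤ Q.natDegree := by
  have hQ0 : Q ≠ 0 := by rintro rfl; exact h1 (dvd_zero _)
  obtain ⟨f, hf, hfQ⟩ := WfDvdMonoid.exists_irreducible_factor hu hQ0
  refine le_trans ?_ (natDegree_le_of_dvd hfQ hQ0)
  have : Fact (Irreducible f) := ⟨hf⟩
  set β := AdjoinRoot.root f with hβ
  have hfin : Module.Finite (ZMod 2) (AdjoinRoot f) := (AdjoinRoot.powerBasis hf.ne_zero).finite
  have : Finite (AdjoinRoot f) := Module.finite_of_finite (ZMod 2)
  have := Fintype.ofFinite (AdjoinRoot f)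
  have hcard : Fintype.card (AdjoinRoot f) = 2 ^ f.natDegree := by
    rw [Module.card_eq_pow_finrank (K := ZMod 2), ZMod.card,
      (AdjoinRoot.powerBasis hf.ne_zero).finrank, AdjoinRoot.powerBasis_dim]
  have hβT : β ^ T = 1 := by
    have := AdjoinRoot.mk_eq_zero.mpr (hfQ.trans hQ)
    rwa [map_sub, map_pow, AdjoinRoot.mk_X, map_one, sub_eq_zero] at this
  have hβ0 : β ≠ 0 := by
    intro h
    rw [h, zero_pow hT] at hβT
    exact zero_ne_one hβT
  have hβ1 : β ≠ 1 := by
    intro h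
    have h2 : f ∣ X - 1 := by
      rw [← AdjoinRoot.mk_eq_zero, map_sub, AdjoinRoot.mk_X, map_one, sub_eq_zero]
      exact h
    have h3 : Irreducible (X - 1 : (ZMod 2)[X]) := by
      simpa using irreducible_X_sub_C (1 : ZMod 2)
    exact h1 (((hf.dvd_irreducible_iff_associated h3).mp h2).symm.dvd.trans hfQ)
  have hpow : β ^ (2 ^ f.natDegree - 1) = 1 := by
    rw [← hcard]
    exact FiniteField.pow_card_sub_one_eq_one β hβ0
  have ho1 : orderOf β ≠ 1 := fun h => hβ1 (orderOf_eq_one_iff.mp h)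
  obtain ⟨q, hq, hqo⟩ := Nat.exists_prime_and_dvd ho1
  refine (hm q hq (hqo.trans (orderOf_dvd_of_pow_eq_one hβT))).trans ?_
  refine Nat.le_of_dvd hf.natDegree_pos ?_
  rw [orderOf_dvd_iff_pow_eq_one]
  have h4 : q ∣ 2 ^ f.natDegree - 1 := hqo.trans (orderOf_dvd_of_pow_eq_one hpow)
  have h5 := (ZMod.natCast_eq_zero_iff _ _).mpr h4
  rw [Nat.cast_sub Nat.one_le_two_pow] at h5
  push_cast at h5
  exact sub_eq_zero.mp h5

lemma add_le_sub_natDegree_gcd {T m : ℕ} (hT : Odd T)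
    (hm : ∀ q : ℕ, q.Prime → q ∣ T → m ≤ orderOf (2 : ZMod q)) (s : ℕ → ZMod 2)
    (hs : ¬ ∃ c, ∀ n < T, s n = c) {S : (ZMod 2)[X]}
    (hS : S = ∑ n ∈ Finset.range T, C (s n) * X ^ n) :
    m + (if S.eval 1 = 0 then 0 else 1) ≤
      T - (EuclideanDomain.gcd ((X : (ZMod 2)[X]) ^ T - 1) S).natDegree := by
  have hT0 : T ≠ 0 := hT.pos.ne'
  have hTF : (T : ZMod 2) ≠ 0 := by
    rw [Ne, ZMod.natCast_eq_zero_iff_even, Nat.not_even_iff_odd]; exact hT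
  have hX0 : (X ^ T - 1 : (ZMod 2)[X]) ≠ 0 := by
    simpa using X_pow_sub_C_ne_zero hT.pos (1 : ZMod 2)
  have hsep : Squarefree (X ^ T - 1 : (ZMod 2)[X]) := by
    have := (separable_X_pow_sub_C (1 : ZMod 2) hTF one_ne_zero).squarefree
    simpa using this
  have hgeom : (X - 1) * ∑ i ∈ Finset.range T, X ^ i = (X ^ T - 1 : (ZMod 2)[X]) :=
    mul_geom_sum X T
  set g := EuclideanDomain.gcd ((X : (ZMod 2)[X]) ^ T - 1) S with hg
  obtain ⟨Q, hQ⟩ : g ∣ X ^ T - 1 := EuclideanDomain.gcd_dvd_left _ _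
  have hgS : g ∣ S := EuclideanDomain.gcd_dvd_right _ _
  have hg0 : g ≠ 0 := by intro h; rw [h, zero_mul] at hQ; exact hX0 hQ
  have hQ0 : Q ≠ 0 := by rintro rfl; rw [mul_zero] at hQ; exact hX0 hQ
  have hdeg : T = g.natDegree + Q.natDegree := by
    rw [← natDegree_mul hg0 hQ0, ← hQ]
    simpa using (natDegree_X_pow_sub_C (n := T) (r := (1 : ZMod 2))).symm
  have hLQ : T - g.natDegree = Q.natDegree := by omega
  rw [hLQ]
  have hX1 : Irreducible (X - 1 : (ZMod 2)[X]) := by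
    simpa using irreducible_X_sub_C (1 : ZMod 2)
  have hndvd : ¬ Q ∣ X - 1 := by
    rintro ⟨R, hR⟩
    have h1 : g = R * ∑ i ∈ Finset.range T, X ^ i := by
      refine mul_right_cancel₀ hQ0 ?_
      rw [← hQ, ← hgeom, hR]; ring
    obtain ⟨A, hA⟩ : (∑ i ∈ Finset.range T, X ^ i : (ZMod 2)[X]) ∣ S :=
      (Dvd.intro_left _ h1.symm).trans hgS
    have hcoefS : ∀ n, S.coeff n = if n < T then s n else 0 := by
      intro n
      rw [hS, finsetSum_coeff]
      simp [coeff_X_pow]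
    have hA0 : A.natDegree = 0 := by
      by_cases hA' : A = 0
      · rw [hA', natDegree_zero]
      have hmon : (∑ i ∈ Finset.range T, X ^ i : (ZMod 2)[X]).Monic := monic_geom_sum_X hT0
      have h2 : S.natDegree ≤ T - 1 := by
        rw [natDegree_le_iff_coeff_eq_zero]
        intro n hn
        rw [hcoefS, if_neg (by omega)]
      have h3 := congrArg natDegree hgeom
      rw [natDegree_mul hX1.ne_zero hmon.ne_zero] at h3
      have h4 : (X - 1 : (ZMod 2)[X]).natDegree = 1 := by
        simpa using natDegree_X_sub_C (1 : ZMod 2)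
      have h5 : (X ^ T - 1 : (ZMod 2)[X]).natDegree = T := by
        simpa using natDegree_X_pow_sub_C (n := T) (r := (1 : ZMod 2))
      rw [hA, natDegree_mul hmon.ne_zero hA'] at h2
      omega
    rw [eq_C_of_natDegree_eq_zero hA0] at hA
    refine hs ⟨A.coeff 0, fun n hn => ?_⟩
    have := hcoefS n
    rw [if_pos hn, hA, coeff_mul_C, finsetSum_coeff] at this
    simpa [coeff_X_pow, hn] using this.symm
  by_cases hXQ : X - 1 ∣ Q
  · obtain ⟨R, hR⟩ := hXQ
    have hR0 : R ≠ 0 := by rintro rfl; rw [mul_zero] at hR; exact hQ0 hR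
    have hRu : ¬ IsUnit R := by
      intro hu
      refine hndvd ?_
      rw [hR]
      exact (associated_mul_unit_left _ _ hu).dvd
    have hXR : ¬ (X - 1 : (ZMod 2)[X]) ∣ R := by
      rintro ⟨R', hR'⟩
      refine hX1.not_isUnit (hsep _ ?_)
      rw [hQ, hR, hR']
      exact ⟨g * R', by ring⟩
    have h1 := natDegree_ge_of_dvd_X_pow_sub_one hT0 hm
      (hQ ▸ (Dvd.intro_left (X - 1) hR.symm).trans (dvd_mul_left Q g)) hRu hXR
    have h2 : Q.natDegree = 1 + R.natDegree := by
      rw [hR, natDegree_mul hX1.ne_zero hR0]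
      congr 1
      simpa using natDegree_X_sub_C (1 : ZMod 2)
    split_ifs <;> omega
  · have hQu : ¬ IsUnit Q := fun hu => hndvd hu.dvd
    have h1 := natDegree_ge_of_dvd_X_pow_sub_one hT0 hm (hQ ▸ dvd_mul_left Q g) hQu hXQ
    rw [if_pos, add_zero]
    · exact h1
    · have h2 : X - 1 ∣ g := by
        refine (hX1.prime.dvd_or_dvd ?_).resolve_right hXQ
        rw [← hQ, ← hgeom]
        exact dvd_mul_right _ _
      have h3 : X - C 1 ∣ S := by simpa using h2.trans hgS
      exact dvd_iff_isRoot.mp h3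

lemma orderOf_neg_of_orderOf_eq {R : Type*} [Ring R] {x : R} {n : ℕ} (hn : 4 ∣ n)
    (hx : orderOf x = n) : orderOf (-x) = n := by
  have h2 : Even n := even_iff_two_dvd.mpr (dvd_trans (by norm_num) hn)
  refine Nat.dvd_antisymm ?_ ?_
  · rw [orderOf_dvd_iff_pow_eq_one, h2.neg_pow, ← hx, pow_orderOf_eq_one]
  · have h := pow_orderOf_eq_one (-x)
    have heven : Even (orderOf (-x)) := by
      by_contra hodd
      have h3 : x ^ (2 * orderOf (-x)) = 1 := by
        rw [← (even_two_mul _).neg_pow, mul_comm, pow_mul, h, one_pow]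
      rw [← orderOf_dvd_iff_pow_eq_one, hx] at h3
      have h4 := hn.trans h3
      rw [Nat.even_iff] at hodd
      omega
    rwa [heven.neg_pow, ← orderOf_dvd_iff_pow_eq_one, hx] at h

lemma sub_mem_primRootsList {p g : ℕ} (hp4 : p % 4 = 1) (hg : g ∈ primRootsList p) :
    p - g ∈ primRootsList p := by
  rw [primRootsList_mem] at hg ⊢
  refine ⟨by omega, ?_⟩
  rw [Nat.cast_sub hg.1.2.le, ZMod.natCast_self, zero_sub]
  exact orderOf_neg_of_orderOf_eq (by omega) hg.2

lemma primRootsList_first_add_last {p T : ℕ} (hp4 : p % 4 = 1)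
    (hlen : (primRootsList p).length = T + 1) :
    (primRootsList p).getD 0 0 + (primRootsList p).getD T 0 = p := by
  have hmono := (primRootsList_sortedLT p).sortedLE.monotone_get
  rw [List.getD_eq_getElem _ _ (by omega), List.getD_eq_getElem _ _ (by omega)]
  have hfirst : ∀ g ∈ primRootsList p, (primRootsList p)[0] ≤ g := by
    intro g hg
    obtain ⟨n, hn, rfl⟩ := List.getElem_of_mem hg
    exact hmono (a := ⟨0, by omega⟩) (b := ⟨n, hn⟩) (Fin.mk_le_mk.mpr (Nat.zero_le n))
  have hlast : ∀ g ∈ primRootsList p, g ≤ (primRootsList p)[T] := by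
    intro g hg
    obtain ⟨n, hn, rfl⟩ := List.getElem_of_mem hg
    exact hmono (a := ⟨n, hn⟩) (b := ⟨T, by omega⟩) (Fin.mk_le_mk.mpr (by omega))
  have h0 : (primRootsList p)[0] ∈ primRootsList p := List.getElem_mem _
  have hT : (primRootsList p)[T] ∈ primRootsList p := List.getElem_mem _
  have h1 := hlast _ (sub_mem_primRootsList hp4 h0)
  have h2 := hfirst _ (sub_mem_primRootsList hp4 hT)
  have h3 := (primRootsList_mem.mp h0).1
  have h4 := (primRootsList_mem.mp hT).1
  omega

lemma eval_one_Spoly {p : ℕ} [Fact p.Prime] (hp4 : p % 4 = 1) : (Spoly p).eval 1 = 1 := by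
  have hlen := length_primRootsList p
  have hφ : 0 < (p - 1).totient := by
    rw [Nat.totient_pos]; have := (Fact.out : p.Prime).one_lt; omega
  obtain ⟨T, hT⟩ : ∃ T, (p - 1).totient = T + 1 := Nat.exists_eq_add_one.mpr hφ
  rw [hT] at hlen
  have hsum := primRootsList_first_add_last hp4 hlen
  rw [Spoly, eval_finsetSum, hT, Nat.add_sub_cancel]
  have hterm : ∀ n ∈ Finset.range T, (C (seqS p n : ZMod 2) * X ^ n).eval 1 =
      ((primRootsList p).getD (n + 1) 0 : ZMod 2) - ((primRootsList p).getD n 0 : ZMod 2) := by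
    intro n hn
    rw [seqS, hT, Nat.add_sub_cancel, Nat.mod_eq_of_lt (Finset.mem_range.mp hn),
      ZMod.natCast_mod, CharTwo.sub_eq_add]
    simp [add_comm]
  rw [Finset.sum_congr rfl hterm,
    Finset.sum_range_sub (fun n => ((primRootsList p).getD n 0 : ZMod 2)), CharTwo.sub_eq_add,
    add_comm, ← Nat.cast_add, hsum, ZMod.natCast_eq_one_iff_odd, Nat.odd_iff]
  omega

/-- For all sufficiently large primes `p`: if `T = φ(p-1) - 1 = q_1^{e_1} ⋯ q_r^{e_r}`
is the prime factorization of `T` into pairwise distinct odd primes, then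
`L(s_n) ≥ min_i ord_{q_i}(2) + ε`, where `ε = 1` if `p ≡ 1 (mod 4)` and `ε = 0`
if `p ≡ 3 (mod 4)`. -/
theorem linear_complexity_lower_bound :
    ∃ P : ℕ, ∀ p : ℕ, Nat.Prime p → P ≤ p →
      ∀ (r : ℕ) (hr : 0 < r) (q e : Fin r → ℕ),
        (∀ i, (q i).Prime) → (∀ i, Odd (q i)) → (∀ i, 1 ≤ e i) →
        Function.Injective q →
        Nat.totient (p - 1) - 1 = ∏ i, q i ^ e i →
        (Finset.univ.inf' ⟨⟨0, hr⟩, Finset.mem_univ _⟩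
            fun i => orderOf ((2 : ZMod (q i)))) +
          (if p % 4 = 1 then 1 else 0) ≤ linComp p := by
  obtain ⟨P, hP⟩ := exists_forall_prime_seqS_not_constant
  refine ⟨P, fun p hp hpP r hr q e hq hodd _ _ hT => ?_⟩
  have := Fact.mk hp
  have hTodd : Odd ((p - 1).totient - 1) := by
    rw [hT]
    exact Finset.prod_induction _ Odd (fun _ _ => Odd.mul) odd_one fun i _ => (hodd i).pow
  have hm : ∀ l : ℕ, l.Prime → l ∣ (p - 1).totient - 1 →
      (Finset.univ.inf' ⟨⟨0, hr⟩, Finset.mem_univ _⟩ fun i => orderOf ((2 : ZMod (q i)))) ≤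
        orderOf (2 : ZMod l) := by
    intro l hl hlT
    rw [hT] at hlT
    obtain ⟨i, -, hi⟩ := (hl.prime.dvd_finsetProd_iff _).mp hlT
    obtain rfl := (Nat.prime_dvd_prime_iff_eq hl (hq i)).mp (hl.dvd_of_dvd_pow hi)
    exact Finset.inf'_le _ (Finset.mem_univ i)
  have hconst : ¬ ∃ c, ∀ n < (p - 1).totient - 1, (seqS p n : ZMod 2) = c := by
    rintro ⟨c, hc⟩
    refine hP p hp hpP ⟨c.val, fun n hn => ?_⟩
    rw [← hc n hn, ZMod.val_natCast, Nat.mod_eq_of_lt]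
    exact Nat.mod_lt _ two_pos
  refine le_trans (Nat.add_le_add_left ?_ _)
    (add_le_sub_natDegree_gcd hTodd hm (fun n => (seqS p n : ZMod 2)) hconst (S := Spoly p) rfl)
  by_cases hp4 : p % 4 = 1
  · rw [if_pos hp4, if_neg]
    rw [eval_one_Spoly hp4]
    exact one_ne_zero
  · rw [if_neg hp4]
    exact Nat.zero_le _
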